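/- arXiv:math/9708213 — 2 statements merged into one kernel-verified Lean document; each statement's English description precedes it below -/
import Mathlib

section
/- Let p ≥ q ≥ r ≥ 1 be integers, let γ be a nonzero complex number, and let A and B be nonzero complex numbers. Then the p+q+r+2 polynomials X^{r+1}(X+γ)^j for j = 1, …, p; X^i(X+γ)^{p+1} for i = 1, …, q+r; A·X^{r+1} + B·(X+γ)^{p+1}; and X^{r+1} are linearly independent over ℂ, and hence form a basis of the space of complex polynomials of degree at most p+q+r+1. -/
open Polynomial

/-- The family of `p + q + r + 2` polynomials from the proof of Theorem 3.7 for `C_{p,q,r}`: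
`X^{r+1}(X+γ)^j` for `j = 1, …, p`; `X^i(X+γ)^{p+1}` for `i = 1, …, q+r`;
`A·X^{r+1} + B·(X+γ)^{p+1}`; and `X^{r+1}`. -/
noncomputable def keyFamily (p q r : ℕ) (γ A B : ℂ) : Fin (p + q + r + 2) → ℂ[X] :=
  fun i =>
    if (i : ℕ) < p then
      X ^ (r + 1) * (X + C γ) ^ ((i : ℕ) + 1)
    else if (i : ℕ) < p + q + r then
      X ^ ((i : ℕ) - p + 1) * (X + C γ) ^ (p + 1)
    else if (i : ℕ) = p + q + r then
      C A * X ^ (r + 1) + C B * (X + C γ) ^ (p + 1)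
    else
      X ^ (r + 1)

theorem kf_ext {n : ℕ} (d : ℂ) (a : ℕ → ℂ)
    (h : (∑ j ∈ Finset.range n, C (a j) * X ^ (j + 1) + C d : ℂ[X]) = 0) :
    d = 0 ∧ ∀ j < n, a j = 0 := by
  constructor
  · have := congrArg (fun f => coeff f 0) h
    simpa [finsetSum_coeff] using this
  · intro j hj
    have := congrArg (fun f => coeff f (j + 1)) h
    simpa [finsetSum_coeff, coeff_X_pow, coeff_C, hj, Finset.sum_ite_eq] using this

theorem kf_deg (n : ℕ) (d : ℂ) (a : ℕ → ℂ) :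
    (∑ j ∈ Finset.range n, C (a j) * X ^ (j + 1) + C d : ℂ[X]).natDegree ≤ n := by
  refine natDegree_add_le_of_degree_le (natDegree_sum_le_of_forall_le _ _ ?_) (by simp)
  intro j hj
  exact (natDegree_C_mul_X_pow_le _ _).trans (by simpa using hj)

theorem kf_linInd
    (p q r : ℕ) (γ A B : ℂ) (hγ : γ ≠ 0) (hB : B ≠ 0) :
    LinearIndependent ℂ (keyFamily p q r γ A B) := by
  rw [Fintype.linearIndependent_iff]
  intro g hg
  set a : ℕ → ℂ := fun i => if h : i < p + q + r + 2 then g ⟨i, h⟩ else 0 with ha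
  have hag : ∀ i : Fin (p + q + r + 2), g i = a i := by
    intro i; simp [ha]
  let F : ℕ → ℂ[X] := fun i => 
    if i < p then
      X ^ (r + 1) * (X + C γ) ^ (i + 1)
    else if i < p + q + r then
      X ^ (i - p + 1) * (X + C γ) ^ (p + 1)
    else if i = p + q + r then
      C A * X ^ (r + 1) + C B * (X + C γ) ^ (p + 1)
    else
      X ^ (r + 1)
  have hF : ∀ i, keyFamily p q r γ A B i = F i := fun i => rfl
  simp only [hF, hag] at hg
  rw [Fin.sum_univ_eq_sum_range (fun i => a i • F i) (p + q + r + 2),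
    Finset.sum_range_succ, Finset.sum_range_succ, add_assoc p q r, Finset.sum_range_add] at hg
  have h1 : ∀ i ∈ Finset.range p, a i • F i =
      X ^ (r + 1) * (C (a i) * (X + C γ) ^ (i + 1)) := by
    intro i hi
    rw [Finset.mem_range] at hi
    simp only [F, if_pos hi, smul_eq_C_mul]; ring
  have h2 : ∀ i ∈ Finset.range (q + r), a (p + i) • F (p + i) =
      (X + C γ) ^ (p + 1) * (C (a (p + i)) * X ^ (i + 1)) := by
    intro i hi
    rw [Finset.mem_range] at hi
    have e1 : ¬ (p + i < p) := by omega
    have e2 : p + i < p + q + r := by omega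
    have e3 : p + i - p + 1 = i + 1 := by omega
    simp only [F, if_neg e1, if_pos e2, smul_eq_C_mul, e3]; ring
  have h3 : F (p + (q + r)) = C A * X ^ (r + 1) + C B * (X + C γ) ^ (p + 1) := by
    simp [F, ← add_assoc]
    intro h; omega
  have h4 : F (p + (q + r) + 1) = X ^ (r + 1) := by
    have e1 : ¬ (p + (q + r) + 1 < p) := by omega
    have e2 : ¬ (p + (q + r) + 1 < p + q + r) := by omega
    have e3 : ¬ (p + (q + r) + 1 = p + q + r) := by omega
    simp only [F, if_neg e1, if_neg e2, if_neg e3]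
  rw [Finset.sum_congr rfl h1, Finset.sum_congr rfl h2, h3, h4, ← Finset.mul_sum,
    ← Finset.mul_sum] at hg
  set c := a (p + (q + r)) with hc
  set d := a (p + (q + r) + 1) with hd
  let P : ℂ[X] := ∑ j ∈ Finset.range p, C (a j) * X ^ (j + 1) + C (c * A + d)
  let Q : ℂ[X] := ∑ j ∈ Finset.range (q + r), C (a (p + j)) * X ^ (j + 1) + C (c * B)
  have hP : P.comp (X + C γ) =
      ∑ j ∈ Finset.range p, C (a j) * (X + C γ) ^ (j + 1) + C (c * A + d) := by
    simp only [P, ← coe_compRingHom_apply, map_add, map_sum]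
    simp
  have key : X ^ (r + 1) * P.comp (X + C γ) + (X + C γ) ^ (p + 1) * Q = 0 := by
    rw [hP, ← hg]
    simp only [Q, smul_eq_C_mul, C_add, C_mul]
    ring
  have hcop : IsCoprime ((X + C γ : ℂ[X]) ^ (p + 1)) (X ^ (r + 1)) := by
    apply IsCoprime.pow
    refine ⟨C γ⁻¹, - C γ⁻¹, ?_⟩
    have : C γ⁻¹ * C γ = (1 : ℂ[X]) := by rw [← C_mul, inv_mul_cancel₀ hγ, C_1]
    linear_combination this
  have hdvd : (X + C γ : ℂ[X]) ^ (p + 1) ∣ P.comp (X + C γ) := by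
    apply hcop.dvd_of_dvd_mul_left
    exact ⟨-Q, by linear_combination key⟩
  have hPc : P.comp (X + C γ) = 0 := by
    apply eq_zero_of_dvd_of_natDegree_lt hdvd
    rw [natDegree_comp, natDegree_pow, natDegree_X_add_C]
    have := kf_deg p (c * A + d) a
    change P.natDegree ≤ p at this
    omega
  have hQ : Q = 0 := by
    rw [hPc, mul_zero, zero_add] at key
    exact (mul_eq_zero.mp key).resolve_left (pow_ne_zero _ (X_add_C_ne_zero γ))
  obtain ⟨q1, q2⟩ := kf_ext (n := q + r) (c * B) (fun j => a (p + j)) hQ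
  have hP0 : P = 0 := by
    have := congrArg (fun f => f.comp (X - C γ)) hPc
    simpa [comp_assoc] using this
  obtain ⟨p1, p2⟩ := kf_ext (n := p) (c * A + d) a hP0
  have hc0 : c = 0 := (mul_eq_zero.mp q1).resolve_right hB
  have hd0 : d = 0 := by simpa [hc0] using p1
  intro i
  rw [hag]
  obtain ⟨i, hi⟩ := i
  change a i = 0
  rcases lt_or_ge i p with h | h
  · exact p2 i h
  obtain ⟨k, rfl⟩ := Nat.exists_eq_add_of_le h
  rcases lt_or_ge k (q + r) with h' | h'
  · exact q2 k h'
  have : k = q + r ∨ k = q + r + 1 := by omega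
  rcases this with rfl | rfl
  · exact hc0
  · exact hd0

/-- For `p ≥ q ≥ r ≥ 1`, `γ ≠ 0`, `A ≠ 0`, `B ≠ 0`, the `p+q+r+2` polynomials
`X^{r+1}(X+γ)^j` (`j = 1, …, p`), `X^i(X+γ)^{p+1}` (`i = 1, …, q+r`),
`A·X^{r+1} + B·(X+γ)^{p+1}`, `X^{r+1}` are linearly independent over `ℂ` and span
the space of complex polynomials of degree at most `p+q+r+1`. -/
theorem keyFamily_linearIndependent_and_spans
    (p q r : ℕ) (hr : 1 ≤ r) (hrq : r ≤ q) (hqp : q ≤ p)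
    (γ A B : ℂ) (hγ : γ ≠ 0) (hA : A ≠ 0) (hB : B ≠ 0) :
    LinearIndependent ℂ (keyFamily p q r γ A B) ∧
      Submodule.span ℂ (Set.range (keyFamily p q r γ A B)) =
        Polynomial.degreeLE ℂ ((p + q + r + 1 : ℕ) : WithBot ℕ) := by
  have hli := kf_linInd p q r γ A B hγ hB
  refine ⟨hli, ?_⟩
  have hfin : Module.finrank ℂ (degreeLT ℂ (p + q + r + 2)) = p + q + r + 2 := by
    rw [(degreeLTEquiv ℂ (p + q + r + 2)).finrank_eq]; simp
  have heq : degreeLE ℂ ((p + q + r + 1 : ℕ) : WithBot ℕ) = degreeLT ℂ (p + q + r + 2) := degreeLT_succ_eq_degreeLE.symm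
  rw [heq]
  have : FiniteDimensional ℂ (degreeLT ℂ (p + q + r + 2)) :=
    (degreeLTEquiv ℂ (p + q + r + 2)).symm.finiteDimensional
  apply Submodule.eq_of_le_of_finrank_eq
  · rw [← heq, Submodule.span_le]
    rintro _ ⟨⟨i, hi⟩, rfl⟩
    rw [SetLike.mem_coe, mem_degreeLE, ← natDegree_le_iff_degree_le]
    unfold keyFamily
    dsimp only
    split_ifs with h1 h2 h3
    · compute_degree
      omega
    · compute_degree
      omega
    · compute_degree
      omega
    · compute_degree
      omega
  · rw [finrank_span_eq_card hli, hfin, Fintype.card_fin]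
end

section
/- Let p ≥ q ≥ r ≥ 1 be integers, let γ be a nonzero complex number, and let A and B be nonzero complex numbers. List the p+q+r+2 polynomials f_1, …, f_{p+q+r+2} given by X^{r+1}(X+γ)^j for j = 1, …, p; X^i(X+γ)^{p+1} for i = 1, …, q+r; A·X^{r+1} + B·(X+γ)^{p+1}; and X^{r+1}. Then for any p+q+r+2 pairwise distinct complex numbers y_1, …, y_{p+q+r+2}, the square evaluation matrix with entries f_i(y_j) is invertible. -/
open Polynomial

lemma aux_coeff (n : ℕ) (c : ℕ → ℂ) (d : ℂ)
    (h : (∑ j ∈ Finset.range n, C (c j) * X ^ (j + 1) + C d : ℂ[X]) = 0) :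
    d = 0 ∧ ∀ j < n, c j = 0 := by
  constructor
  · have := congrArg (fun P => P.coeff 0) h
    simpa [finsetSum_coeff, coeff_X_pow] using this
  · intro j hj
    have := congrArg (fun P => P.coeff (j + 1)) h
    simp only [coeff_add, finsetSum_coeff, coeff_C_mul, coeff_X_pow, coeff_C_succ, coeff_zero,
      add_zero, add_left_inj, mul_ite, mul_one, mul_zero] at this
    rw [Finset.sum_ite_eq] at this
    simpa [hj] using this

lemma aux_deg (n : ℕ) (c : ℕ → ℂ) (d : ℂ) :
    (∑ j ∈ Finset.range n, C (c j) * X ^ (j + 1) + C d : ℂ[X]).natDegree ≤ n := by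
  refine natDegree_add_le_of_degree_le (natDegree_sum_le_of_forall_le _ _ ?_) (by simp)
  intro j hj
  have := Finset.mem_range.1 hj
  exact (natDegree_C_mul_X_pow_le _ _).trans (by omega)


/-- For `p ≥ q ≥ r ≥ 1`, `γ ≠ 0`, `A ≠ 0`, `B ≠ 0`, and any `p+q+r+2` pairwise distinct
complex numbers `y_1, …, y_{p+q+r+2}`, the square evaluation matrix of the family
`X^{r+1}(X+γ)^j` (`j = 1, …, p`), `X^i(X+γ)^{p+1}` (`i = 1, …, q+r`),
`A·X^{r+1} + B·(X+γ)^{p+1}`, `X^{r+1}` at these points is invertible. -/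
theorem keyFamily_evalMatrix_invertible
    (p q r : ℕ) (hr : 1 ≤ r) (hrq : r ≤ q) (hqp : q ≤ p)
    (γ A B : ℂ) (hγ : γ ≠ 0) (hA : A ≠ 0) (hB : B ≠ 0)
    (y : Fin (p + q + r + 2) → ℂ) (hy : Function.Injective y) :
    IsUnit (Matrix.of fun i j : Fin (p + q + r + 2) =>
      (keyFamily p q r γ A B i).eval (y j)) := by
  rw [← Matrix.vecMul_injective_iff_isUnit]
  refine (injective_iff_map_eq_zero (Matrix.vecMulLinear _)).2 ?_
  intro v hv
  set w : ℕ → ℂ := fun n => if h : n < p + q + r + 2 then v ⟨n, h⟩ else 0 with hw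
  have hwv : ∀ i : Fin (p + q + r + 2), w i = v i := fun i => by simp [hw]
  set a := w (p + (q + r)) with ha
  set b := w (p + (q + r) + 1) with hb
  set F : ℂ[X] := ∑ j ∈ Finset.range p, C (w j) * X ^ (j + 1) + C (A * a + b) with hF
  set G : ℂ[X] := ∑ j ∈ Finset.range (q + r), C (w (p + j)) * X ^ (j + 1) + C (B * a) with hG
  have hFd : F.natDegree ≤ p := aux_deg _ _ _
  have hGd : G.natDegree ≤ q + r := aux_deg _ _ _
  set P : ℂ[X] := X ^ (r + 1) * taylor γ F + (X + C γ) ^ (p + 1) * G with hP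
  have hsum : ∑ i, C (v i) * keyFamily p q r γ A B i = P := by
    let g : ℕ → ℂ[X] := fun i => C (w i) * (if i < p then
      X ^ (r + 1) * (X + C γ) ^ (i + 1)
    else if i < p + q + r then
      X ^ (i - p + 1) * (X + C γ) ^ (p + 1)
    else if i = p + q + r then
      C A * X ^ (r + 1) + C B * (X + C γ) ^ (p + 1)
    else
      X ^ (r + 1))
    have h1 : ∑ i, C (v i) * keyFamily p q r γ A B i
        = ∑ i ∈ Finset.range (p + q + r + 2), g i := by
      rw [Finset.sum_range]
      refine Finset.sum_congr rfl fun i _ => ?_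
      simp only [g, hwv, keyFamily]
    have e1 : ∑ i ∈ Finset.range p, g i
        = X ^ (r + 1) * ∑ j ∈ Finset.range p, C (w j) * (X + C γ) ^ (j + 1) := by
      rw [Finset.mul_sum]
      refine Finset.sum_congr rfl fun i hi => ?_
      simp only [g, if_pos (Finset.mem_range.1 hi)]
      ring
    have e2 : ∑ i ∈ Finset.range (q + r), g (p + i)
        = (X + C γ) ^ (p + 1) * ∑ j ∈ Finset.range (q + r), C (w (p + j)) * X ^ (j + 1) := by
      rw [Finset.mul_sum]
      refine Finset.sum_congr rfl fun i hi => ?_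
      have := Finset.mem_range.1 hi
      simp only [g]
      rw [if_neg (by omega), if_pos (by omega), Nat.add_sub_cancel_left]
      ring
    have e3 : g (p + (q + r)) = C a * (C A * X ^ (r + 1) + C B * (X + C γ) ^ (p + 1)) := by
      simp only [g]
      rw [if_neg (by omega), if_neg (by omega), if_pos (by omega)]
    have e4 : g (p + (q + r) + 1) = C b * X ^ (r + 1) := by
      simp only [g]
      rw [if_neg (by omega), if_neg (by omega), if_neg (by omega)]
    have e5 : taylor γ F = ∑ j ∈ Finset.range p, C (w j) * (X + C γ) ^ (j + 1)
        + C (A * a + b) := by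
      simp only [hF, map_add, map_sum, taylor_mul, taylor_C, taylor_pow, taylor_X]
    rw [h1, show p + q + r + 2 = p + (q + r) + 1 + 1 by ring, Finset.sum_range_succ,
      Finset.sum_range_succ, Finset.sum_range_add, e1, e2, e3, e4, hP, e5, hG]
    simp only [C_add, C_mul]
    ring
  have hPd : P.natDegree < p + q + r + 2 := by
    refine Nat.lt_succ_of_le (natDegree_add_le_of_degree_le ?_ ?_)
    · refine natDegree_mul_le.trans ?_
      rw [natDegree_X_pow, natDegree_taylor]
      omega
    · refine natDegree_mul_le.trans ?_
      rw [natDegree_pow, natDegree_X_add_C]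
      omega
  have hP0 : P = 0 := by
    refine eq_zero_of_natDegree_lt_card_of_eval_eq_zero P hy ?_ (by simpa using hPd)
    intro j
    have := congrFun hv j
    rw [← hsum, eval_finsetSum]
    simpa [Matrix.vecMul, dotProduct] using this
  have hcop : IsCoprime ((X + C γ : ℂ[X]) ^ (p + 1)) (X ^ (r + 1)) := by
    refine IsCoprime.pow ⟨C γ⁻¹, - C γ⁻¹, ?_⟩
    have : (C γ⁻¹ * C γ : ℂ[X]) = 1 := by rw [← C_mul, inv_mul_cancel₀ hγ, C_1]
    linear_combination this
  have hF0 : F = 0 := by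
    have hd : (X + C γ : ℂ[X]) ^ (p + 1) ∣ taylor γ F := by
      refine hcop.dvd_of_dvd_mul_left ⟨-G, ?_⟩
      linear_combination hP.symm.trans hP0
    have := eq_zero_of_dvd_of_natDegree_lt hd (by
      rw [natDegree_taylor, natDegree_pow, natDegree_X_add_C]; omega)
    exact taylor_injective γ (by simpa using this)
  have hG0 : G = 0 := by
    have h := hP.symm.trans hP0
    rw [hF0, map_zero, mul_zero, zero_add] at h
    exact (mul_eq_zero.1 h).resolve_left (pow_ne_zero _ (X_add_C_ne_zero γ))
  obtain ⟨h1, h2⟩ := aux_coeff _ _ _ hF0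
  obtain ⟨h3, h4⟩ := aux_coeff _ (fun j => w (p + j)) _ hG0
  have ha0 : a = 0 := (mul_eq_zero.1 h3).resolve_left hB
  have hb0 : b = 0 := by simpa [ha0] using h1
  ext i
  rw [← hwv i]
  have hi := i.2
  by_cases c1 : (i : ℕ) < p
  · exact h2 _ c1
  by_cases c2 : (i : ℕ) < p + (q + r)
  · have := h4 (i - p) (by omega)
    simpa [Nat.add_sub_cancel' (not_lt.1 c1)] using this
  by_cases c3 : (i : ℕ) = p + (q + r)
  · rw [c3]; exact ha0
  · rw [show (i : ℕ) = p + (q + r) + 1 by omega]; exact hb0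
end
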